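/- Let f be a bounded continuous square-integrable density with distribution function F, and suppose λ_N = m/N → λ with 0 < λ < 1 as N = m+n → ∞. Then the Pitman efficiency of the Wilcoxon rank sum statistic is e_P[W_2] = lim_N (N V_0[W_2])^{-1/2} (d/dθ) E_θ[W_2] |_{θ=0} = √(12 λ(1−λ)) ∫_{-∞}^∞ f^2(x) dx, where E_θ[W_2] = mn ∫ f(y) F(y+θ) dy and V_0[W_2] is the variance of W_2 under the null hypothesis; in particular the derivative (d/dθ) ∫ f(y) F(y+θ) dy |_{θ=0} equals ∫ f^2(x) dx. -/

import Mathlib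

open MeasureTheory ProbabilityTheory Filter Asymptotics Set
open scoped Topology ENNReal NNReal BigOperators

noncomputable section

/-- The `k`-th order statistic (1-indexed) of a finite sample: the smallest point `x`
such that at least `k` of the observations are `≤ x`. -/
def orderStat {N : ℕ} (w : Fin N → ℝ) (k : ℕ) : ℝ :=
  sInf {x : ℝ | k ≤ (Finset.univ.filter fun i => w i ≤ x).card}

/-- The sample median: the `((N+1)/2)`-th order statistic for odd `N`, the average of the
`(N/2)`-th and `(N/2+1)`-th order statistics for even `N`. -/
def sampleMedian {N : ℕ} (w : Fin N → ℝ) : ℝ :=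
  if N % 2 = 1 then orderStat w ((N + 1) / 2)
  else (orderStat w (N / 2) + orderStat w (N / 2 + 1)) / 2

/-- The measure on `ℝ` with Lebesgue density `f`. -/
def densMeasure (f : ℝ → ℝ) : Measure ℝ :=
  MeasureTheory.volume.withDensity fun x => ENNReal.ofReal (f x)

/-- Joint law of the two independent samples: `X_1, …, X_m` i.i.d. with density `f`
and `Y_1, …, Y_n` i.i.d. with density `f(· - θ)`, all independent. -/
def twoSampleLaw (f : ℝ → ℝ) (m n : ℕ) (θ : ℝ) :
    Measure ((Fin m → ℝ) × (Fin n → ℝ)) :=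
  (Measure.pi fun _ : Fin m => densMeasure f).prod
    (Measure.pi fun _ : Fin n => (densMeasure f).map (· + θ))

/-- Integrated kernel `K(t) = ∫_{-∞}^t k(u) du`. -/
def Kfun (k : ℝ → ℝ) (t : ℝ) : ℝ := ∫ u in Set.Iic t, k u

/-- The median test statistic `M† = ∑_{i=1}^m ψ*(Z - X_i)` with `ψ*(x) = 1` for `x > 0`. -/
def MdagStat {m n : ℕ} (p : (Fin m → ℝ) × (Fin n → ℝ)) : ℝ :=
  ∑ i : Fin m, if 0 < sampleMedian (Fin.append p.1 p.2) - p.1 i then (1:ℝ) else 0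

/-- The smoothed median test statistic `M̃ = ∑_{i=1}^m K*((Z - X_i)/h)`. -/
def MtilStat (kstar : ℝ → ℝ) (h : ℝ) {m n : ℕ} (p : (Fin m → ℝ) × (Fin n → ℝ)) : ℝ :=
  ∑ i : Fin m, Kfun kstar ((sampleMedian (Fin.append p.1 p.2) - p.1 i) / h)

/-- The Wilcoxon rank sum statistic `W₂ = ∑_i ∑_j ψ(Y_j - X_i)` with `ψ(x) = 1` for `x ≥ 0`. -/
def W2Stat {m n : ℕ} (p : (Fin m → ℝ) × (Fin n → ℝ)) : ℝ :=
  ∑ i : Fin m, ∑ j : Fin n, if 0 ≤ p.2 j - p.1 i then (1:ℝ) else 0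

/-- The smoothed Wilcoxon statistic `W̃₂ = ∑_i ∑_j K((Y_j - X_i)/h)`. -/
def WtilStat (k : ℝ → ℝ) (h : ℝ) {m n : ℕ} (p : (Fin m → ℝ) × (Fin n → ℝ)) : ℝ :=
  ∑ i : Fin m, ∑ j : Fin n, Kfun k ((p.2 j - p.1 i) / h)

/-- The standard normal distribution function `Φ`. -/
def stdGaussCDF (x : ℝ) : ℝ :=
  ((ProbabilityTheory.gaussianReal 0 1) (Set.Iic x)).toReal

/-- The Beta function `B(a,b) = ∫_0^1 t^{a-1} (1-t)^{b-1} dt`. -/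
def Beta (a b : ℝ) : ℝ := ∫ t in Set.Ioo (0:ℝ) 1, t ^ (a - 1) * (1 - t) ^ (b - 1)

lemma integral_comp_of_measurePreserving {α β : Type*} [MeasurableSpace α] [MeasurableSpace β]
    {μ : Measure α} {ν : Measure β} {φ : α → β} (hφ : MeasurePreserving φ μ ν) {g : β → ℝ}
    (hg : AEStronglyMeasurable g ν) : ∫ x, g (φ x) ∂μ = ∫ y, g y ∂ν := by
  rw [← hφ.map_eq] at hg ⊢
  exact (integral_map hφ.measurable.aemeasurable hg).symm

lemma measurePreserving_pi_pair {ι α : Type*} [Fintype ι] [MeasurableSpace α]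
    (μ : Measure α) [IsProbabilityMeasure μ] {i k : ι} (hik : i ≠ k) :
    MeasurePreserving (fun x : ι → α => (x i, x k)) (Measure.pi fun _ => μ) (μ.prod μ) := by
  refine ⟨by fun_prop, ?_⟩
  have h := (iIndepFun_pi (μ := fun _ : ι => μ) (X := fun _ => id)
    (fun _ => aemeasurable_id)).indepFun hik
  rw [h.map_prod_eq_prod_map_map (measurable_pi_apply i).aemeasurable
    (measurable_pi_apply k).aemeasurable]
  exact congrArg₂ Measure.prod (measurePreserving_eval (fun _ : ι => μ) i).map_eq
    (measurePreserving_eval (fun _ : ι => μ) k).map_eq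

section TwoSample

variable {ι κ α β : Type*} [Fintype ι] [Fintype κ] [MeasurableSpace α] [MeasurableSpace β]
  (μ : Measure α) (ν : Measure β) [IsProbabilityMeasure μ] [IsProbabilityMeasure ν]

lemma measurePreserving_twoSample_pair (i : ι) (j : κ) :
    MeasurePreserving (fun p : (ι → α) × (κ → β) => (p.1 i, p.2 j))
      ((Measure.pi fun _ => μ).prod (Measure.pi fun _ => ν)) (μ.prod ν) :=
  (measurePreserving_eval (fun _ : ι => μ) i).prod (measurePreserving_eval (fun _ : κ => ν) j)

/-- The mean of a two-sample U-statistic. -/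
lemma integral_twoSample_sum {h : α × β → ℝ} (hh : Integrable h (μ.prod ν)) :
    ∫ p : (ι → α) × (κ → β), ∑ i, ∑ j, h (p.1 i, p.2 j)
        ∂((Measure.pi fun _ => μ).prod (Measure.pi fun _ => ν)) =
      Fintype.card ι * Fintype.card κ * ∫ q, h q ∂(μ.prod ν) := by
  have hint (i : ι) (j : κ) : Integrable (fun p : (ι → α) × (κ → β) => h (p.1 i, p.2 j))
      ((Measure.pi fun _ => μ).prod (Measure.pi fun _ => ν)) :=
    (measurePreserving_twoSample_pair μ ν i j).integrable_comp_of_integrable hh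
  have hval (i : ι) (j : κ) : ∫ p : (ι → α) × (κ → β), h (p.1 i, p.2 j)
      ∂((Measure.pi fun _ => μ).prod (Measure.pi fun _ => ν)) = ∫ q, h q ∂(μ.prod ν) :=
    integral_comp_of_measurePreserving (measurePreserving_twoSample_pair μ ν i j)
      hh.aestronglyMeasurable
  rw [integral_finsetSum _ fun i _ => integrable_finsetSum _ fun j _ => hint i j]
  simp_rw [fun i => integral_finsetSum Finset.univ fun j _ => hint i j, hval]
  simp [mul_assoc]

lemma integral_twoSample_mul [DecidableEq ι] [DecidableEq κ] {h : α × β → ℝ}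
    (hh : MemLp h 2 (μ.prod ν)) (i k : ι) (j l : κ) :
    ∫ p : (ι → α) × (κ → β), h (p.1 i, p.2 j) * h (p.1 k, p.2 l)
        ∂((Measure.pi fun _ => μ).prod (Measure.pi fun _ => ν)) =
      if i = k then
        if j = l then ∫ q, h q ^ 2 ∂(μ.prod ν) else ∫ a, (∫ b, h (a, b) ∂ν) ^ 2 ∂μ
      else
        if j = l then ∫ b, (∫ a, h (a, b) ∂μ) ^ 2 ∂ν else (∫ q, h q ∂(μ.prod ν)) ^ 2 := by
  split_ifs with hik hjl hjl
  · subst hik hjl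
    simp_rw [← sq]
    exact integral_comp_of_measurePreserving (g := fun q => h q ^ 2)
      (measurePreserving_twoSample_pair μ ν i j) (hh.aestronglyMeasurable.pow 2)
  · subst hik
    have hint : Integrable (fun q : α × β × β => h (q.1, q.2.1) * h (q.1, q.2.2))
        (μ.prod (ν.prod ν)) :=
      (hh.comp_measurePreserving ((MeasurePreserving.id μ).prod measurePreserving_fst)).integrable_mul
        (hh.comp_measurePreserving ((MeasurePreserving.id μ).prod measurePreserving_snd))
    refine (integral_comp_of_measurePreserving (φ := fun p : (ι → α) × (κ → β) => (p.1 i, p.2 j, p.2 l))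
      ((measurePreserving_eval (fun _ : ι => μ) i).prod (measurePreserving_pi_pair ν hjl))
      hint.aestronglyMeasurable).trans ?_
    rw [integral_prod _ hint]
    simp_rw [sq, ← integral_prod_mul]
  · subst hjl
    have hint : Integrable (fun q : (α × α) × β => h (q.1.1, q.2) * h (q.1.2, q.2))
        ((μ.prod μ).prod ν) :=
      (hh.comp_measurePreserving (measurePreserving_fst.prod (MeasurePreserving.id ν))).integrable_mul
        (hh.comp_measurePreserving (measurePreserving_snd.prod (MeasurePreserving.id ν)))
    refine (integral_comp_of_measurePreserving (φ := fun p : (ι → α) × (κ → β) => ((p.1 i, p.1 k), p.2 j))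
      ((measurePreserving_pi_pair μ hik).prod (measurePreserving_eval (fun _ : κ => ν) j))
      hint.aestronglyMeasurable).trans ?_
    rw [integral_prod_symm _ hint]
    simp_rw [sq, ← integral_prod_mul]
  · have hint : Integrable (fun q : (α × α) × β × β => h (q.1.1, q.2.1) * h (q.1.2, q.2.2))
        ((μ.prod μ).prod (ν.prod ν)) :=
      (hh.comp_measurePreserving (measurePreserving_fst.prod measurePreserving_fst)).integrable_mul
        (hh.comp_measurePreserving (measurePreserving_snd.prod measurePreserving_snd))
    refine (integral_comp_of_measurePreserving (φ := fun p : (ι → α) × (κ → β) => ((p.1 i, p.1 k), p.2 j, p.2 l))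
      ((measurePreserving_pi_pair μ hik).prod (measurePreserving_pi_pair ν hjl))
      hint.aestronglyMeasurable).trans ?_
    rw [integral_prod _ hint]
    have hmul (q : α × α) : ∫ z : β × β, h (q.1, z.1) * h (q.2, z.2) ∂(ν.prod ν) =
        (∫ b, h (q.1, b) ∂ν) * ∫ b, h (q.2, b) ∂ν :=
      integral_prod_mul (fun b => h (q.1, b)) (fun b => h (q.2, b))
    simp_rw [hmul]
    rw [integral_prod_mul (fun a => ∫ b, h (a, b) ∂ν) (fun a => ∫ b, h (a, b) ∂ν), ← sq,
      integral_prod _ (hh.integrable (by norm_num))]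

/-- The variance of a two-sample U-statistic. -/
lemma variance_twoSample_sum {h : α × β → ℝ} (hh : MemLp h 2 (μ.prod ν)) :
    variance (fun p : (ι → α) × (κ → β) => ∑ i, ∑ j, h (p.1 i, p.2 j))
        ((Measure.pi fun _ => μ).prod (Measure.pi fun _ => ν)) =
      Fintype.card ι * Fintype.card κ *
        ((∫ q, h q ^ 2 ∂(μ.prod ν)) - (∫ q, h q ∂(μ.prod ν)) ^ 2 +
          (Fintype.card κ - 1) *
            ((∫ a, (∫ b, h (a, b) ∂ν) ^ 2 ∂μ) - (∫ q, h q ∂(μ.prod ν)) ^ 2) +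
          (Fintype.card ι - 1) *
            ((∫ b, (∫ a, h (a, b) ∂μ) ^ 2 ∂ν) - (∫ q, h q ∂(μ.prod ν)) ^ 2)) := by
  classical
  have hL (r : ι × κ) : MemLp (fun p : (ι → α) × (κ → β) => h (p.1 r.1, p.2 r.2)) 2
      ((Measure.pi fun _ => μ).prod (Measure.pi fun _ => ν)) :=
    hh.comp_measurePreserving (measurePreserving_twoSample_pair μ ν r.1 r.2)
  simp_rw [← Fintype.sum_prod_type' (fun i j => h (_, _))]
  rw [variance_fun_sum hL]
  simp_rw [fun r s => covariance_eq_sub (hL r) (hL s), Pi.mul_apply, integral_twoSample_mul μ ν hh,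
    fun r : ι × κ => integral_comp_of_measurePreserving
      (measurePreserving_twoSample_pair μ ν r.1 r.2) hh.aestronglyMeasurable]
  generalize (∫ q, h q ^ 2 ∂(μ.prod ν)) = A
  generalize (∫ a, (∫ b, h (a, b) ∂ν) ^ 2 ∂μ) = B
  generalize (∫ b, (∫ a, h (a, b) ∂μ) ^ 2 ∂ν) = C
  generalize (∫ q, h q ∂(μ.prod ν)) = D
  have key (i k : ι) (j l : κ) :
      (if i = k then if j = l then A else B else if j = l then C else D ^ 2) - D * D =
        (if j = l then if i = k then A - B - C + D ^ 2 else 0 else 0) +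
          (if i = k then B - D ^ 2 else 0) + (if j = l then C - D ^ 2 else 0) := by
    split_ifs <;> ring
  simp_rw [Fintype.sum_prod_type]
  refine (Finset.sum_congr rfl fun i _ => Finset.sum_congr rfl fun j _ =>
    Finset.sum_congr rfl fun k _ => Finset.sum_congr rfl fun l _ => key i k j l).trans ?_
  simp only [Finset.sum_add_distrib, Finset.sum_ite_eq, Finset.mem_univ, if_true, Finset.sum_const, Finset.card_univ,
    nsmul_eq_mul, mul_ite, mul_zero]
  ring

end TwoSample

section Density

variable {f F : ℝ → ℝ}

lemma isProbabilityMeasure_densMeasure (hf0 : ∀ x, 0 ≤ f x) (hfi : ∫ x, f x = 1) :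
    IsProbabilityMeasure (densMeasure f) := by
  refine ⟨?_⟩
  rw [densMeasure, withDensity_apply _ MeasurableSet.univ, setLIntegral_univ,
    ← ofReal_integral_eq_lintegral_ofReal (integrable_of_integral_eq_one hfi)
      (Eventually.of_forall hf0), hfi, ENNReal.ofReal_one]

lemma integral_densMeasure (hf0 : ∀ x, 0 ≤ f x) (hfc : Continuous f) (g : ℝ → ℝ) :
    ∫ x, g x ∂(densMeasure f) = ∫ x, f x * g x := by
  rw [densMeasure, integral_withDensity_eq_integral_toReal_smul (by fun_prop) (by simp)]
  simp [ENNReal.toReal_ofReal (hf0 _)]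

lemma measureReal_densMeasure_Iic (hf0 : ∀ x, 0 ≤ f x) (hfi : ∫ x, f x = 1) (x : ℝ) :
    (densMeasure f).real (Iic x) = ∫ t in Iic x, f t := by
  rw [measureReal_def, densMeasure, withDensity_apply _ measurableSet_Iic,
    integral_eq_lintegral_of_nonneg_ae (Eventually.of_forall hf0)
      (integrable_of_integral_eq_one hfi).aestronglyMeasurable.restrict]

lemma cdf_densMeasure (hf0 : ∀ x, 0 ≤ f x) (hfi : ∫ x, f x = 1)
    (hF : ∀ x, F x = ∫ t in Iic x, f t) (x : ℝ) : cdf (densMeasure f) x = F x := by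
  have := isProbabilityMeasure_densMeasure hf0 hfi
  rw [cdf_eq_real, measureReal_densMeasure_Iic hf0 hfi, hF]

lemma hasDerivAt_integral_Iic (hfi : Integrable f) (hfc : Continuous f)
    (hF : ∀ x, F x = ∫ t in Iic x, f t) (x : ℝ) : HasDerivAt F (f x) x := by
  have h : F = fun y => F 0 + ∫ t in (0 : ℝ)..y, f t := by
    ext y
    rw [← intervalIntegral.integral_Iic_sub_Iic hfi.integrableOn hfi.integrableOn, hF 0, hF y]
    ring
  rw [h]
  exact (intervalIntegral.integral_hasDerivAt_right (hfc.intervalIntegrable _ _)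
    (hfc.stronglyMeasurableAtFilter _ _) hfc.continuousAt).const_add _

lemma integral_mul_cdf_pow (hf0 : ∀ x, 0 ≤ f x) (hfi : ∫ x, f x = 1) (hfc : Continuous f)
    (hF : ∀ x, F x = ∫ t in Iic x, f t) (k : ℕ) :
    Integrable (fun x => f x * F x ^ k) ∧ ∫ x, f x * F x ^ k = 1 / (k + 1) := by
  have := isProbabilityMeasure_densMeasure hf0 hfi
  have hint := integrable_of_integral_eq_one hfi
  have hFcdf : ⇑(cdf (densMeasure f)) = F := funext (cdf_densMeasure hf0 hfi hF)
  have hd := hasDerivAt_integral_Iic hint hfc hF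
  have hFc : Continuous F := continuous_iff_continuousAt.2 fun x => (hd x).continuousAt
  have hbot : Tendsto F atBot (𝓝 0) := hFcdf ▸ tendsto_cdf_atBot _
  have htop : Tendsto F atTop (𝓝 1) := hFcdf ▸ tendsto_cdf_atTop _
  have hi : Integrable fun x => f x * F x ^ k := by
    refine hint.mul_bdd (c := 1) (by fun_prop) (Eventually.of_forall fun x => ?_)
    have h0 : 0 ≤ F x := hFcdf ▸ cdf_nonneg _ x
    have h1 : F x ≤ 1 := hFcdf ▸ cdf_le_one _ x
    rw [Real.norm_of_nonneg (by positivity)]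
    exact pow_le_one₀ h0 h1
  refine ⟨hi, ?_⟩
  have hk : (k + 1 : ℝ) ≠ 0 := by positivity
  rw [integral_of_hasDerivAt_of_tendsto (f := fun x => F x ^ (k + 1) / (k + 1)) (m := 0)
    (n := 1 / (k + 1)) (fun x => ?deriv) hi ?bot ?top, sub_zero]
  case deriv =>
    refine (((hd x).fun_pow (k + 1)).div_const (k + 1 : ℝ)).congr_deriv ?_
    rw [Nat.add_sub_cancel]
    push_cast
    field_simp
  case bot => simpa using (hbot.pow (k + 1)).div_const (k + 1 : ℝ)
  case top => simpa using (htop.pow (k + 1)).div_const (k + 1 : ℝ)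

lemma hasDerivAt_integral_mul_cdf_add (hf0 : ∀ x, 0 ≤ f x) (hfi : ∫ x, f x = 1)
    (hfc : Continuous f) (hfb : ∃ C, ∀ x, f x ≤ C) (hF : ∀ x, F x = ∫ t in Iic x, f t) :
    HasDerivAt (fun θ => ∫ y, f y * F (y + θ)) (∫ x, f x ^ 2) 0 := by
  obtain ⟨C, hC⟩ := hfb
  have hint := integrable_of_integral_eq_one hfi
  have hd := hasDerivAt_integral_Iic hint hfc hF
  have hFc : Continuous F := continuous_iff_continuousAt.2 fun x => (hd x).continuousAt
  have h := (hasDerivAt_integral_of_dominated_loc_of_deriv_le (μ := volume) (x₀ := (0 : ℝ))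
    (F := fun θ y => f y * F (y + θ)) (F' := fun θ y => f y * f (y + θ)) (s := univ)
    (bound := fun y => f y * C) univ_mem
    (Eventually.of_forall fun θ => by fun_prop)
    (by simpa using (integral_mul_cdf_pow hf0 hfi hfc hF 1).1) (by fun_prop)
    (Eventually.of_forall fun y θ _ => by
      rw [Real.norm_of_nonneg (mul_nonneg (hf0 _) (hf0 _))]
      exact mul_le_mul_of_nonneg_left (hC _) (hf0 _))
    (hint.mul_const C)
    (Eventually.of_forall fun y θ _ => ((hd _).comp_const_add y θ).const_mul _)).2
  simpa [sq] using h

/-- The indicator that the first coordinate does not exceed the second. -/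
def wilcoxonKernel (q : ℝ × ℝ) : ℝ := if 0 ≤ q.2 - q.1 then 1 else 0

lemma memLp_wilcoxonKernel (ρ : Measure (ℝ × ℝ)) [IsFiniteMeasure ρ] (p : ℝ≥0∞) :
    MemLp wilcoxonKernel p ρ := by
  refine MemLp.of_bound (C := 1) ?_ (Eventually.of_forall fun q => ?_)
  · exact (Measurable.ite (measurableSet_le measurable_const
      (measurable_snd.sub measurable_fst)) measurable_const measurable_const).aestronglyMeasurable
  · unfold wilcoxonKernel
    split_ifs <;> simp

lemma integral_wilcoxonKernel_left (μ : Measure ℝ) (b : ℝ) :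
    ∫ a, wilcoxonKernel (a, b) ∂μ = μ.real (Iic b) := by
  rw [← integral_indicator_one measurableSet_Iic]
  simp [wilcoxonKernel, indicator_apply]

lemma integral_wilcoxonKernel_right (μ : Measure ℝ) [IsProbabilityMeasure μ] [NullSingletonClass μ] (a : ℝ) :
    ∫ b, wilcoxonKernel (a, b) ∂μ = 1 - μ.real (Iic a) := by
  rw [← probReal_compl_eq_one_sub measurableSet_Iic, compl_Iic,
    ← measureReal_congr Ioi_ae_eq_Ici.symm, ← integral_indicator_one measurableSet_Ici]
  simp [wilcoxonKernel, indicator_apply]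

lemma integral_W2Stat_twoSampleLaw (hf0 : ∀ x, 0 ≤ f x) (hfi : ∫ x, f x = 1)
    (hfc : Continuous f) (hF : ∀ x, F x = ∫ t in Iic x, f t) (m n : ℕ) (θ : ℝ) :
    ∫ p, W2Stat p ∂(twoSampleLaw f m n θ) = m * n * ∫ y, f y * F (y + θ) := by
  have := isProbabilityMeasure_densMeasure hf0 hfi
  have : IsProbabilityMeasure ((densMeasure f).map (· + θ)) :=
    Measure.isProbabilityMeasure_map (by fun_prop)
  have hFm : Measurable F := by
    rw [← funext (cdf_densMeasure hf0 hfi hF)]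
    exact (cdf _).mono.measurable
  have hint := (memLp_wilcoxonKernel
    ((densMeasure f).prod ((densMeasure f).map (· + θ))) 1).integrable le_rfl
  have h := integral_twoSample_sum (ι := Fin m) (κ := Fin n) _ _ hint
  rw [Fintype.card_fin, Fintype.card_fin, integral_prod_symm _ hint] at h
  simp_rw [integral_wilcoxonKernel_left, measureReal_densMeasure_Iic hf0 hfi, ← hF] at h
  rw [integral_map (by fun_prop) hFm.aestronglyMeasurable, integral_densMeasure hf0 hfc] at h
  exact h

/-- The null variance of the Wilcoxon rank sum statistic. -/
lemma variance_W2Stat_twoSampleLaw_zero (hf0 : ∀ x, 0 ≤ f x) (hfi : ∫ x, f x = 1)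
    (hfc : Continuous f) (m n : ℕ) :
    variance (fun p => W2Stat p) (twoSampleLaw f m n 0) = m * n * (m + n + 1) / 12 := by
  have := isProbabilityMeasure_densMeasure hf0 hfi
  have : NullSingletonClass (densMeasure f) := by unfold densMeasure; infer_instance
  have hI1 := integral_mul_cdf_pow hf0 hfi hfc (fun _ => rfl) 1
  have hI2 := integral_mul_cdf_pow hf0 hfi hfc (fun _ => rfl) 2
  have hL (p : ℝ≥0∞) := memLp_wilcoxonKernel ((densMeasure f).prod (densMeasure f)) p
  have h := variance_twoSample_sum (ι := Fin m) (κ := Fin n) _ _ (hL 2)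
  have hsq (q : ℝ × ℝ) : wilcoxonKernel q ^ 2 = wilcoxonKernel q := by simp [wilcoxonKernel]
  have hcompl (x : ℝ) : f x * (1 - ∫ t in Iic x, f t) ^ 2 =
      f x - 2 * (f x * (∫ t in Iic x, f t) ^ 1) + f x * (∫ t in Iic x, f t) ^ 2 := by ring
  simp_rw [hsq] at h
  rw [Fintype.card_fin, Fintype.card_fin, integral_prod_symm _ ((hL 1).integrable le_rfl)] at h
  simp_rw [integral_wilcoxonKernel_left, integral_wilcoxonKernel_right,
    measureReal_densMeasure_Iic hf0 hfi, integral_densMeasure hf0 hfc, hcompl] at h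
  rw [integral_add (f := fun x => f x - 2 * (f x * (∫ t in Iic x, f t) ^ 1))
      ((integrable_of_integral_eq_one hfi).sub (hI1.1.const_mul 2)) hI2.1,
    integral_sub (integrable_of_integral_eq_one hfi) (hI1.1.const_mul 2),
    integral_const_mul, hfi, hI1.2, hI2.2] at h
  simp only [pow_one] at hI1
  rw [hI1.2] at h
  simp only [twoSampleLaw, add_zero, Measure.map_id']
  refine h.trans ?_
  push_cast
  ring

end Density

lemma rpow_neg_half_mul_eq_sqrt {q v : ℝ} (hq : 0 ≤ q) (hv : 0 ≤ v) :
    v ^ (-(1 : ℝ) / 2) * q = Real.sqrt (q ^ 2 / v) := by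
  rw [Real.sqrt_div (sq_nonneg q), Real.sqrt_sq hq, neg_div, Real.rpow_neg hv,
    ← Real.sqrt_eq_rpow, div_eq_inv_mul]

/-- For a bounded continuous square-integrable density `f`, the Pitman
efficiency of the Wilcoxon rank sum statistic is `√(12λ(1-λ)) ∫ f²`; in particular
`(d/dθ) ∫ f(y) F(y+θ) dy |_{θ=0} = ∫ f²`. -/
theorem stmt_10
    (f : ℝ → ℝ) (hf0 : ∀ x, 0 ≤ f x) (hfi : ∫ x, f x = 1)
    (hfc : Continuous f) (hfb : ∃ C, ∀ x, f x ≤ C)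
    (hf2 : Integrable fun x => f x ^ 2)
    (F : ℝ → ℝ) (hF : ∀ x, F x = ∫ t in Set.Iic x, f t)
    (m n : ℕ → ℕ) (hmn : ∀ N, m N + n N = N)
    (l : ℝ) (hl0 : 0 < l) (hl1 : l < 1)
    (hlam : Tendsto (fun N => (m N : ℝ) / N) atTop (𝓝 l)) :
    deriv (fun θ => ∫ y, f y * F (y + θ)) 0 = (∫ x, f x ^ 2) ∧
    Tendsto (fun N : ℕ =>
        ((N : ℝ) * variance (fun p => W2Stat p)
            (twoSampleLaw f (m N) (n N) 0)) ^ (-(1:ℝ)/2) *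
          deriv (fun θ => ∫ p, W2Stat p ∂(twoSampleLaw f (m N) (n N) θ)) 0)
      atTop (𝓝 (Real.sqrt (12 * l * (1 - l)) * ∫ x, f x ^ 2)) := by
  have hder := hasDerivAt_integral_mul_cdf_add hf0 hfi hfc hfb hF
  refine ⟨hder.deriv, ?_⟩
  have hsplit : ∀ᶠ N : ℕ in atTop, (n N : ℝ) / N = 1 - (m N : ℝ) / N := by
    filter_upwards [eventually_ne_atTop 0] with N hN
    have hN' : (N : ℝ) ≠ 0 := by exact_mod_cast hN
    have : (m N : ℝ) + n N = N := by exact_mod_cast hmn N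
    field_simp
    linarith
  have hnlam : Tendsto (fun N => (n N : ℝ) / N) atTop (𝓝 (1 - l)) :=
    (hlam.const_sub 1).congr' (hsplit.mono fun _ h => h.symm)
  have hlim := (((((hlam.const_mul 12).mul hnlam).mul
    (tendsto_natCast_div_add_atTop (1 : ℝ))).sqrt).mul_const (∫ x, f x ^ 2))
  rw [mul_one] at hlim
  refine hlim.congr' ?_
  filter_upwards [eventually_ne_atTop 0] with N hN
  have hN' : (N : ℝ) ≠ 0 := by exact_mod_cast hN
  have hNpos : (N : ℝ) + 1 ≠ 0 := by positivity
  have hsum : (m N : ℝ) + n N = N := by exact_mod_cast hmn N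
  simp_rw [integral_W2Stat_twoSampleLaw hf0 hfi hfc hF]
  rw [(hder.const_mul _).deriv, variance_W2Stat_twoSampleLaw_zero hf0 hfi hfc, hsum, ← mul_assoc,
    rpow_neg_half_mul_eq_sqrt (by positivity) (by positivity)]
  congr 2
  by_cases hm : (m N : ℝ) = 0
  · simp [hm]
  by_cases hn : (n N : ℝ) = 0
  · simp [hn]
  field_simp
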